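/- Let H be a real Hilbert space and let A ⊆ H be a nonempty bounded subset with Chebyshev centre Z(A) and Chebyshev radius ρ(A). Then (1) Z(A) belongs to the closed convex hull of A, and (2) for every nonempty subset B ⊆ A with Chebyshev centre Z(B) and radius ρ(B) one has ‖Z(A) − Z(B)‖ ≤ √(ρ(A)² − ρ(B)²). -/

import Mathlib

theorem bddAbove_range_norm_sub {H : Type*} [NormedAddCommGroup H] {A : Set H}
    (hA : Bornology.IsBounded A) (x : H) :
    BddAbove (Set.range fun a : A => ‖x - (a : H)‖) := by
  obtain ⟨R, hR⟩ := hA.exists_norm_le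
  refine ⟨‖x‖ + R, ?_⟩
  rintro _ ⟨a, rfl⟩
  exact (norm_sub_le _ _).trans (by gcongr; exact hR a a.2)

theorem iInf_iSup_norm_sub_le {H : Type*} [NormedAddCommGroup H] (A : Set H) (x : H) :
    (⨅ x : H, ⨆ a : A, ‖x - (a : H)‖) ≤ ⨆ a : A, ‖x - (a : H)‖ := by
  refine ciInf_le ⟨0, ?_⟩ x
  rintro _ ⟨y, rfl⟩
  exact Real.iSup_nonneg fun _ => norm_nonneg _

theorem norm_convex_combination_sq {H : Type*} [NormedAddCommGroup H] [InnerProductSpace ℝ H]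
    (u v : H) (t : ℝ) :
    ‖(1 - t) • u + t • v‖ ^ 2 =
      (1 - t) * ‖u‖ ^ 2 + t * ‖v‖ ^ 2 - t * (1 - t) * ‖v - u‖ ^ 2 := by
  rw [norm_add_sq_real, norm_sub_sq_real, norm_smul, norm_smul, mul_pow, mul_pow,
    real_inner_smul_left, real_inner_smul_right, Real.norm_eq_abs, Real.norm_eq_abs, sq_abs,
    sq_abs, real_inner_comm u v]
  ring

theorem le_of_forall_one_sub_mul_le {c d : ℝ}
    (h : ∀ t : ℝ, 0 < t → t < 1 → (1 - t) * d ≤ c) : d ≤ c := by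
  by_contra! hlt
  have hhalf := h (1 / 2) (by norm_num) (by norm_num)
  have hc : 0 ≤ c := by linarith
  have hd : 0 < d := hc.trans_lt hlt
  have key := h ((d - c) / (2 * d)) (div_pos (by linarith) (by linarith))
    ((div_lt_one (by linarith)).2 (by linarith))
  have : (1 - (d - c) / (2 * d)) * d = (d + c) / 2 := by field_simp; ring
  linarith

/-- The squared radius function of a bounded set grows at least quadratically away from a
Chebyshev centre `z`. -/
theorem chebyshev_radius_sq_add_norm_sub_sq_le
    {H : Type*} [NormedAddCommGroup H] [InnerProductSpace ℝ H]
    {A : Set H} (hA : A.Nonempty) (hAbdd : Bornology.IsBounded A) {z : H}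
    (hz : (⨆ a : A, ‖z - (a : H)‖) = ⨅ x : H, ⨆ a : A, ‖x - (a : H)‖) (x : H) :
    (⨆ a : A, ‖z - (a : H)‖) ^ 2 + ‖x - z‖ ^ 2 ≤ (⨆ a : A, ‖x - (a : H)‖) ^ 2 := by
  have : Nonempty A := hA.to_subtype
  set r := ⨆ a : A, ‖z - (a : H)‖
  set s := ⨆ a : A, ‖x - (a : H)‖
  have hr : 0 ≤ r := Real.iSup_nonneg fun _ => norm_nonneg _
  suffices ‖x - z‖ ^ 2 ≤ s ^ 2 - r ^ 2 by linarith
  refine le_of_forall_one_sub_mul_le fun t ht ht1 => ?_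
  set M := (1 - t) * r ^ 2 + t * s ^ 2 - t * (1 - t) * ‖x - z‖ ^ 2 with hM
  have hpt (a : A) : ‖(1 - t) • z + t • x - (a : H)‖ ^ 2 ≤ M := by
    have hcomb : (1 - t) • z + t • x - (a : H) = (1 - t) • (z - a) + t • (x - a) := by module
    have hza : ‖z - a‖ ≤ r := le_ciSup (bddAbove_range_norm_sub hAbdd z) a
    have hxa : ‖x - a‖ ≤ s := le_ciSup (bddAbove_range_norm_sub hAbdd x) a
    rw [hcomb, norm_convex_combination_sq, sub_sub_sub_cancel_right, hM]
    have : 0 ≤ 1 - t := by linarith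
    gcongr
  have hM0 : 0 ≤ M := (sq_nonneg _).trans (hpt (Classical.arbitrary A))
  have hbound : r ≤ √M := hz.trans_le <| (iInf_iSup_norm_sub_le A ((1 - t) • z + t • x)).trans
    (ciSup_le fun a => Real.le_sqrt_of_sq_le (hpt a))
  have hsq : r ^ 2 ≤ M := (Real.le_sqrt hr hM0).1 hbound
  refine le_of_mul_le_mul_left ?_ ht
  linarith

/-- **Chebyshev centres in Hilbert spaces.** Let `A` be a nonempty bounded subset of a
real Hilbert space `H`, with Chebyshev centre `zA` (the point realising the Chebyshev
radius `ρ(A) = ⨅ x, ⨆ a ∈ A, ‖x - a‖`).  Then: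
(1) `zA` lies in the closed convex hull of `A`; and
(2) for every nonempty subset `B ⊆ A` with Chebyshev centre `zB`,
    `‖zA - zB‖ ≤ √(ρ(A)² - ρ(B)²)`. -/
theorem chebyshev_centre_hilbert
    {H : Type*} [NormedAddCommGroup H] [InnerProductSpace ℝ H] [CompleteSpace H]
    (A : Set H) (hA : A.Nonempty) (hAbdd : Bornology.IsBounded A)
    (zA : H)
    (hzA : (⨆ a : A, ‖zA - (a : H)‖) = ⨅ x : H, ⨆ a : A, ‖x - (a : H)‖)
    (B : Set H) (hBA : B ⊆ A) (hB : B.Nonempty)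
    (zB : H)
    (hzB : (⨆ b : B, ‖zB - (b : H)‖) = ⨅ x : H, ⨆ b : B, ‖x - (b : H)‖) :
    zA ∈ closure (convexHull ℝ A) ∧
    ‖zA - zB‖ ≤
      Real.sqrt ((⨅ x : H, ⨆ a : A, ‖x - (a : H)‖) ^ 2
        - (⨅ x : H, ⨆ b : B, ‖x - (b : H)‖) ^ 2) := by
  have : Nonempty B := hB.to_subtype
  constructor
  · have hne : (closure (convexHull ℝ A)).Nonempty := (hA.convexHull).closure
    have hconv : Convex ℝ (closure (convexHull ℝ A)) := (convex_convexHull ℝ A).closure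
    obtain ⟨p, hp, hmin⟩ :=
      exists_norm_eq_iInf_of_complete_convex hne isClosed_closure.isComplete hconv zA
    rw [norm_eq_iInf_iff_real_inner_le_zero hconv hp] at hmin
    have hle : (⨆ a : A, ‖p - (a : H)‖) ≤ ⨆ a : A, ‖zA - (a : H)‖ := by
      refine ciSup_mono (bddAbove_range_norm_sub hAbdd zA) fun a => ?_
      have hinner := hmin a (subset_closure (subset_convexHull ℝ A a.2))
      have hexp := norm_sub_sq_real (zA - p) ((a : H) - p)
      rw [sub_sub_sub_cancel_right, norm_sub_rev (a : H) p] at hexp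
      exact (pow_le_pow_iff_left₀ (norm_nonneg _) (norm_nonneg _) two_ne_zero).1
        (by nlinarith [sq_nonneg ‖zA - p‖])
    have hgrow := chebyshev_radius_sq_add_norm_sub_sq_le hA hAbdd hzA p
    have hsq := pow_le_pow_left₀ (Real.iSup_nonneg fun a : A => norm_nonneg (p - (a : H))) hle 2
    have hzero : ‖p - zA‖ ^ 2 = 0 := le_antisymm (by linarith) (sq_nonneg _)
    rw [sq_eq_zero_iff, norm_eq_zero, sub_eq_zero] at hzero
    exact hzero ▸ hp
  · have hgrow := chebyshev_radius_sq_add_norm_sub_sq_le hB (hAbdd.subset hBA) hzB zA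
    have hle : (⨆ b : B, ‖zA - (b : H)‖) ≤ ⨆ a : A, ‖zA - (a : H)‖ :=
      ciSup_le fun b => le_ciSup (bddAbove_range_norm_sub hAbdd zA) ⟨b, hBA b.2⟩
    have hsq := pow_le_pow_left₀ (Real.iSup_nonneg fun b : B => norm_nonneg (zA - (b : H))) hle 2
    rw [← hzA, ← hzB]
    exact Real.le_sqrt_of_sq_le (by linarith)
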